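/- arXiv:1802.07363 — 3 statements merged into one kernel-verified Lean document; each statement's English description precedes it below -/
import Mathlib

section
/- For every integer d ≥ 1 and all real numbers a, b, c, e, the following identity holds: ∑_{n=1}^{d} C(d,n) a^n c^{d−n} + ∑_{n=1}^{d−1} C(d,n) a^n [ (c+e)^{d−n} − c^{d−n} ] + ∑_{n=2}^{d} C(d,n) ∑_{m=1}^{n−1} C(n,m) (m/n) a^m b^{n−m} (c+e)^{d−n} = a · ∑_{n=1}^{d} C(d,n) (c+e)^{d−n} (a+b)^{n−1}. (Here C(d,n) denotes the binomial coefficient, empty sums are 0, and in the queueing interpretation a = u_{k−1} − u_k, b = v_{k−1} − v_k, c = u_k, e = v_k, so the right-hand side equals (u_{k−1} − u_k)·W_k, the probability that an arriving task joins a working virtual machine with exactly k−1 tasks under the power-of-d sampling scheme.) -/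
open Finset

/-- The size-biased binomial expansion, with the top term `a ^ n` split off. -/
theorem sum_choose_mul_div_mul_pow_add_pow {n : ℕ} (hn : 1 ≤ n) (a b : ℝ) :
    (∑ m ∈ Finset.Icc 1 (n - 1), (n.choose m : ℝ) * ((m : ℝ) / (n : ℝ)) *
      a ^ m * b ^ (n - m)) + a ^ n = a * (a + b) ^ (n - 1) := by
  obtain ⟨k, rfl⟩ := Nat.exists_eq_add_of_le' hn
  rw [Nat.add_sub_cancel, ← Finset.Ico_add_one_right_eq_Icc, Finset.sum_Ico_eq_sum_range,
    Nat.add_sub_cancel, add_pow, Finset.mul_sum, Finset.sum_range_succ]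
  congr 1
  · refine Finset.sum_congr rfl fun j _ => ?_
    have h : ((k : ℝ) + 1) * (k.choose j : ℝ) = ((k + 1).choose (j + 1) : ℝ) * ((j : ℝ) + 1) := by
      exact_mod_cast Nat.add_one_mul_choose_eq k j
    have hk : (k : ℝ) + 1 ≠ 0 := by positivity
    rw [add_comm 1 j, Nat.add_sub_add_right, ← mul_div_assoc]
    push_cast
    rw [← h, mul_div_cancel_left₀ _ hk]
    ring
  · simp [pow_succ']

/-- The three routing possibilities in the power-of-`d` scheme sum up to
`(u_{k-1} - u_k) W_k`, where `a = u_{k-1} - u_k`, `b = v_{k-1} - v_k`, `c = u_k`,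
`e = v_k`. -/
theorem routing_probability_identity (d : ℕ) (hd : 1 ≤ d) (a b c e : ℝ) :
    (∑ n ∈ Finset.Icc 1 d, (d.choose n : ℝ) * a ^ n * c ^ (d - n)) +
    (∑ n ∈ Finset.Icc 1 (d - 1), (d.choose n : ℝ) * a ^ n *
        ((c + e) ^ (d - n) - c ^ (d - n))) +
    (∑ n ∈ Finset.Icc 2 d, (d.choose n : ℝ) *
        ∑ m ∈ Finset.Icc 1 (n - 1), (n.choose m : ℝ) * ((m : ℝ) / (n : ℝ)) *
          a ^ m * b ^ (n - m) * (c + e) ^ (d - n)) =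
    a * ∑ n ∈ Finset.Icc 1 d, (d.choose n : ℝ) * (c + e) ^ (d - n) * (a + b) ^ (n - 1) := by
  have h_extend : ∑ n ∈ Finset.Icc 1 (d - 1), (d.choose n : ℝ) * a ^ n *
        ((c + e) ^ (d - n) - c ^ (d - n)) =
      ∑ n ∈ Finset.Icc 1 d, (d.choose n : ℝ) * a ^ n *
        ((c + e) ^ (d - n) - c ^ (d - n)) := by
    refine Finset.sum_subset (Finset.Icc_subset_Icc_right (Nat.sub_le d 1)) fun n hn hn' => ?_
    have : n = d := by
      simp only [Finset.mem_Icc] at hn hn'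
      omega
    simp [this]
  have h_mixed : ∑ n ∈ Finset.Icc 2 d, (d.choose n : ℝ) *
        ∑ m ∈ Finset.Icc 1 (n - 1), (n.choose m : ℝ) * ((m : ℝ) / (n : ℝ)) *
          a ^ m * b ^ (n - m) * (c + e) ^ (d - n) =
      ∑ n ∈ Finset.Icc 1 d, (d.choose n : ℝ) *
        ∑ m ∈ Finset.Icc 1 (n - 1), (n.choose m : ℝ) * ((m : ℝ) / (n : ℝ)) *
          a ^ m * b ^ (n - m) * (c + e) ^ (d - n) := by
    refine Finset.sum_subset (Finset.Icc_subset_Icc_left one_le_two) fun n hn hn' => ?_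
    have : n = 1 := by
      simp only [Finset.mem_Icc] at hn hn'
      omega
    simp [this]
  rw [h_extend, h_mixed, ← Finset.sum_add_distrib, ← Finset.sum_add_distrib, Finset.mul_sum]
  refine Finset.sum_congr rfl fun n hn => ?_
  rw [← Finset.sum_mul]
  linear_combination (d.choose n : ℝ) * (c + e) ^ (d - n) *
    sum_choose_mul_div_mul_pow_add_pow (Finset.mem_Icc.mp hn).1 a b
end

section
/- Let d ≥ 1 and M ≥ 2 be integers and let λ, μ > 0 be reals. Define P(a,b) = ∑_{n=1}^{d} C(d,n) (a−b)^{n−1} b^{d−n}, so that (a−b)·P(a,b) = a^d − b^d. Let (δ_k)_{k≥1} be a real sequence with 1 ≥ δ_1 ≥ δ_2 ≥ ⋯ ≥ 0 and δ_k → 0 as k → ∞, and let ξ_0, ξ_1, …, ξ_{M−1} be reals with 1 ≥ ξ_0 ≥ ξ_1 ≥ ⋯ ≥ ξ_{M−1} ≥ 0 and ξ_0 + δ_1 = 1. Set W_1 = P(δ_1 + ξ_0, δ_1 + ξ_1), W_k = P(δ_{k−1} + ξ_{k−1}, δ_k + ξ_k) for 2 ≤ k ≤ M−1, W_M = P(δ_{M−1}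 + ξ_{M−1}, δ_M), and W_k = P(δ_{k−1}, δ_k) for k ≥ M+1. Suppose the stationary mean field equations hold: μ(δ_2 − δ_1) + λ ξ_{M−1} W_M = 0; λ(δ_{k−1} − δ_k) W_k + μ(δ_{k+1} − δ_k) + λ ξ_{M−1} W_M = 0 for k = 2, …, M; λ(δ_{k−1} − δ_k) W_k + μ(δ_{k+1} − δ_k) = 0 for all k ≥ M+1; and λ(ξ_{j−1} − ξ_j) W_j − λ ξ_{M−1} W_M = 0 for j = 1, …, M−1. Then λ(ξ_0 + δ_1)^d = μ δ_1; consequently δ_1 = λ/μ and ξ_0 = 1 − λ/μ. -/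
open Finset

/-- `P(a,b) = ∑_{n=1}^{d} C(d,n) (a-b)^{n-1} b^{d-n}`, so that
`(a-b) * P(a,b) = a^d - b^d`. -/
noncomputable def Pfun (d : ℕ) (a b : ℝ) : ℝ :=
  ∑ n ∈ Finset.Icc 1 d, (d.choose n : ℝ) * (a - b) ^ (n - 1) * b ^ (d - n)

theorem sub_mul_Pfun (d : ℕ) (a b : ℝ) : (a - b) * Pfun d a b = a ^ d - b ^ d := by
  have h : a ^ d = ∑ n ∈ Finset.range (d + 1), (a - b) ^ n * b ^ (d - n) * (d.choose n : ℝ) := by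
    rw [← add_pow, sub_add_cancel]
  rw [h, Finset.sum_range_succ', Pfun, Finset.mul_sum, Finset.range_eq_Ico,
    Finset.sum_Ico_add' (fun n => (a - b) ^ n * b ^ (d - n) * (d.choose n : ℝ)) 0 d 1]
  simp only [pow_zero, Nat.sub_zero, Nat.choose_zero_right, Nat.cast_one, one_mul, mul_one,
    add_sub_cancel_right, zero_add]
  refine Finset.sum_congr (by ext n; simp only [Finset.mem_Icc, Finset.mem_Ico]; omega) ?_
  intro n hn
  obtain ⟨m, rfl⟩ := Nat.exists_eq_add_of_le' (Finset.mem_Icc.mp hn).1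
  rw [Nat.add_sub_cancel, pow_succ]
  ring

/-- Summing the stationary mean field equations yields `λ (ξ_0 + δ_1)^d = μ δ_1`;
with the normalization `ξ_0 + δ_1 = 1` this gives `δ_1 = λ/μ` and `ξ_0 = 1 - λ/μ`. -/
theorem stationary_normalization (d M : ℕ) (hd : 1 ≤ d) (hM : 2 ≤ M)
    (lam mu : ℝ) (hlam : 0 < lam) (hmu : 0 < mu)
    (δ ξ : ℕ → ℝ)
    (hδ1 : δ 1 ≤ 1) (hδnn : ∀ k, 1 ≤ k → 0 ≤ δ k)
    (hδanti : ∀ k, 1 ≤ k → δ (k + 1) ≤ δ k)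
    (hδlim : Filter.Tendsto δ Filter.atTop (nhds 0))
    (hξ0 : ξ 0 ≤ 1) (hξnn : 0 ≤ ξ (M - 1))
    (hξanti : ∀ j, j + 1 ≤ M - 1 → ξ (j + 1) ≤ ξ j)
    (hnorm : ξ 0 + δ 1 = 1)
    (W : ℕ → ℝ)
    (hW1 : W 1 = Pfun d (δ 1 + ξ 0) (δ 1 + ξ 1))
    (hWmid : ∀ k, 2 ≤ k → k ≤ M - 1 → W k = Pfun d (δ (k - 1) + ξ (k - 1)) (δ k + ξ k))
    (hWM : W M = Pfun d (δ (M - 1) + ξ (M - 1)) (δ M))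
    (hWhigh : ∀ k, M + 1 ≤ k → W k = Pfun d (δ (k - 1)) (δ k))
    (heq1 : mu * (δ 2 - δ 1) + lam * ξ (M - 1) * W M = 0)
    (heq2 : ∀ k, 2 ≤ k → k ≤ M →
      lam * (δ (k - 1) - δ k) * W k + mu * (δ (k + 1) - δ k) +
        lam * ξ (M - 1) * W M = 0)
    (heq3 : ∀ k, M + 1 ≤ k →
      lam * (δ (k - 1) - δ k) * W k + mu * (δ (k + 1) - δ k) = 0)
    (heq4 : ∀ j, 1 ≤ j → j ≤ M - 1 →
      lam * (ξ (j - 1) - ξ j) * W j - lam * ξ (M - 1) * W M = 0) :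
    lam * (ξ 0 + δ 1) ^ d = mu * δ 1 ∧ δ 1 = lam / mu ∧ ξ 0 = 1 - lam / mu := by
  have low : ∀ k, 1 ≤ k → k ≤ M - 1 →
      lam * ((δ 1 + ξ 0) ^ d - (δ k + ξ k) ^ d) = mu * (δ 1 - δ (k + 1)) := by
    intro k hk
    induction k, hk using Nat.le_induction with
    | base =>
      intro h
      have e := heq4 1 le_rfl h
      have p := sub_mul_Pfun d (δ 1 + ξ 0) (δ 1 + ξ 1)
      rw [← hW1] at p
      rw [← p]
      norm_num at e ⊢
      linear_combination e + heq1
    | succ k hk ih =>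
      intro h
      have i := ih (by omega)
      have e := heq4 (k + 1) (by omega) h
      have f := heq2 (k + 1) (by omega) (by omega)
      have w := hWmid (k + 1) (by omega) h
      rw [Nat.add_sub_cancel] at e f w
      have p := sub_mul_Pfun d (δ k + ξ k) (δ (k + 1) + ξ (k + 1))
      rw [← w] at p
      linear_combination i + e + f - lam * p
  have high : ∀ k, M ≤ k →
      lam * ((δ 1 + ξ 0) ^ d - δ k ^ d) = mu * (δ 1 - δ (k + 1)) := by
    intro k hk
    induction k, hk using Nat.le_induction with
    | base =>
      have i := low (M - 1) (by omega) le_rfl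
      rw [Nat.sub_add_cancel (by omega)] at i
      have f := heq2 M hM le_rfl
      have p := sub_mul_Pfun d (δ (M - 1) + ξ (M - 1)) (δ M)
      rw [← hWM] at p
      linear_combination i + f - lam * p
    | succ k hk i =>
      have f := heq3 (k + 1) (by omega)
      have w := hWhigh (k + 1) (by omega)
      rw [Nat.add_sub_cancel] at f w
      have p := sub_mul_Pfun d (δ k) (δ (k + 1))
      rw [← w] at p
      linear_combination i + f - lam * p
  have total : lam * (ξ 0 + δ 1) ^ d = mu * δ 1 := by
    have l₁ : Filter.Tendsto (fun k => lam * ((δ 1 + ξ 0) ^ d - δ k ^ d)) Filter.atTop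
        (nhds (lam * ((δ 1 + ξ 0) ^ d - 0 ^ d))) :=
      ((hδlim.pow d).const_sub _).const_mul _
    have l₂ : Filter.Tendsto (fun k => mu * (δ 1 - δ (k + 1))) Filter.atTop
        (nhds (mu * (δ 1 - 0))) :=
      ((hδlim.comp (Filter.tendsto_add_atTop_nat 1)).const_sub _).const_mul _
    have h := tendsto_nhds_unique_of_eventuallyEq l₁ l₂
      (Filter.eventually_atTop.mpr ⟨M, high⟩)
    rwa [zero_pow (by omega), sub_zero, sub_zero, add_comm (δ 1)] at h
  have hδ : δ 1 = lam / mu := by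
    rw [eq_div_iff hmu.ne']
    rw [hnorm, one_pow] at total
    linarith
  exact ⟨total, hδ, by linarith⟩
end

section
/- The drift map F(u,v) = ((y_{u_k}(u,v))_{k≥1}, (y_{v_j}(u,v))_{0≤j≤M−1}) is Lipschitz continuous on Ω with respect to the supremum norm: there exists a constant L > 0, depending only on d, M, λ and μ, such that for all (u,v), (u′,v′) ∈ Ω, sup{ sup_{k≥1} |y_{u_k}(u,v) − y_{u_k}(u′,v′)|, max_{0≤j≤M−1} |y_{v_j}(u,v) − y_{v_j}(u′,v′)| } ≤ L · sup{ sup_{k≥1} |u_k − u′_k|, max_{0≤j≤M−1} |v_j − v′_j| }. -/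
open Finset

/-- Membership in the state space `Ω`. -/
def memOmega (M : ℕ) (u v : ℕ → ℝ) : Prop :=
  u 1 ≤ 1 ∧ (∀ k, 1 ≤ k → 0 ≤ u k) ∧ (∀ k, 1 ≤ k → u (k + 1) ≤ u k) ∧
  v 0 ≤ 1 ∧ (∀ j, j ≤ M - 1 → 0 ≤ v j) ∧ (∀ j, j + 1 ≤ M - 1 → v (j + 1) ≤ v j)

/-- The sampling weights `W_k` of the power-of-`d` scheme with threshold `M`. -/
noncomputable def Wfun (d M : ℕ) (u v : ℕ → ℝ) (k : ℕ) : ℝ :=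
  if k = 1 then
    ∑ n ∈ Finset.Icc 1 d, (d.choose n : ℝ) * (v 0 - v 1) ^ (n - 1) * (v 1 + u 1) ^ (d - n)
  else if k ≤ M - 1 then
    ∑ n ∈ Finset.Icc 1 d, (d.choose n : ℝ) * (u k + v k) ^ (d - n) *
      (u (k - 1) - u k + v (k - 1) - v k) ^ (n - 1)
  else if k = M then
    ∑ n ∈ Finset.Icc 1 d, (d.choose n : ℝ) * (u M) ^ (d - n) *
      (u (M - 1) - u M + v (M - 1)) ^ (n - 1)
  else
    ∑ n ∈ Finset.Icc 1 d, (d.choose n : ℝ) * (u (k - 1) - u k) ^ (n - 1) * (u k) ^ (d - n)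

/-- The drift `y_{u_k}` of the mean field equations. -/
noncomputable def yU (d M : ℕ) (lam mu : ℝ) (u v : ℕ → ℝ) (k : ℕ) : ℝ :=
  if k = 1 then mu * (u 2 - u 1) + lam * v (M - 1) * Wfun d M u v M
  else if k ≤ M then
    lam * (u (k - 1) - u k) * Wfun d M u v k + mu * (u (k + 1) - u k) +
      lam * v (M - 1) * Wfun d M u v M
  else lam * (u (k - 1) - u k) * Wfun d M u v k + mu * (u (k + 1) - u k)

/-- The drift `y_{v_j}` of the mean field equations. -/
noncomputable def yV (d M : ℕ) (lam mu : ℝ) (u v : ℕ → ℝ) (j : ℕ) : ℝ :=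
  if j = 0 then mu * (u 1 - u 2) - lam * v (M - 1) * Wfun d M u v M
  else lam * (v (j - 1) - v j) * Wfun d M u v j - lam * v (M - 1) * Wfun d M u v M

/-- The polynomial in two variables of which every sampling weight is a value. -/
noncomputable def samplingPoly (d : ℕ) (a b : ℝ) : ℝ :=
  ∑ n ∈ Finset.Icc 1 d, (d.choose n : ℝ) * a ^ (n - 1) * b ^ (d - n)

lemma exists_lipschitz_mul_samplingPoly (d : ℕ) :
    ∃ K : ℝ, 0 ≤ K ∧ ∀ t a b t' a' b' ε : ℝ, |t| ≤ 2 → |a| ≤ 2 → |b| ≤ 2 →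
      |t'| ≤ 2 → |a'| ≤ 2 → |b'| ≤ 2 → |t - t'| ≤ ε → |a - a'| ≤ ε → |b - b'| ≤ ε →
      |t * samplingPoly d a b - t' * samplingPoly d a' b'| ≤ K * ε := by
  have hsmooth : ContDiff ℝ 1 (fun p : ℝ × ℝ × ℝ => p.1 * samplingPoly d p.2.1 p.2.2) := by
    unfold samplingPoly
    fun_prop
  obtain ⟨K, hK⟩ := hsmooth.locallyLipschitz.locallyLipschitzOn
    |>.exists_lipschitzOnWith_of_compact (isCompact_closedBall (0 : ℝ × ℝ × ℝ) 2)
  refine ⟨K, K.2, fun t a b t' a' b' ε ht ha hb ht' ha' hb' h₁ h₂ h₃ => ?_⟩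
  have hmem : ∀ x y z : ℝ, |x| ≤ 2 → |y| ≤ 2 → |z| ≤ 2 →
      (x, y, z) ∈ Metric.closedBall (0 : ℝ × ℝ × ℝ) 2 := by
    intro x y z hx hy hz
    simp [Prod.norm_def, hx, hy, hz]
  have hdist := hK.dist_le_mul (t, a, b) (hmem t a b ht ha hb) (t', a', b')
    (hmem t' a' b' ht' ha' hb')
  rw [Real.dist_eq] at hdist
  refine hdist.trans (mul_le_mul_of_nonneg_left ?_ K.2)
  simp [Prod.dist_eq, Real.dist_eq, h₁, h₂, h₃]

lemma memOmega.u_mem {M : ℕ} {u v : ℕ → ℝ} (h : memOmega M u v) {k : ℕ} (hk : 1 ≤ k) :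
    0 ≤ u k ∧ u k ≤ 1 := by
  obtain ⟨h1, h0, hanti, -⟩ := h
  refine ⟨h0 k hk, ?_⟩
  induction k, hk using Nat.le_induction with
  | base => exact h1
  | succ k hk ih => exact (hanti k hk).trans ih

lemma memOmega.v_mem {M : ℕ} {u v : ℕ → ℝ} (h : memOmega M u v) {j : ℕ} (hj : j ≤ M - 1) :
    0 ≤ v j ∧ v j ≤ 1 := by
  obtain ⟨-, -, -, h1, h0, hanti⟩ := h
  refine ⟨h0 j hj, ?_⟩
  induction j with
  | zero => exact h1
  | succ j ih => exact (hanti j hj).trans (ih (by omega))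

lemma abs_sub_le_one_of_mem {x y : ℝ} (hx : 0 ≤ x ∧ x ≤ 1) (hy : 0 ≤ y ∧ y ≤ 1) :
    |x - y| ≤ 1 := by
  rw [abs_le]
  constructor <;> linarith [hx.1, hx.2, hy.1, hy.2]

/-- The first argument of `samplingPoly` in the weight `W_k`. -/
noncomputable def levelGap (M : ℕ) (u v : ℕ → ℝ) (k : ℕ) : ℝ :=
  if k = 1 then v 0 - v 1
  else if k ≤ M - 1 then u (k - 1) - u k + v (k - 1) - v k
  else if k = M then u (M - 1) - u M + v (M - 1)
  else u (k - 1) - u k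

/-- The second argument of `samplingPoly` in the weight `W_k`. -/
noncomputable def levelTail (M : ℕ) (u v : ℕ → ℝ) (k : ℕ) : ℝ :=
  if k = 1 then v 1 + u 1
  else if k ≤ M - 1 then u k + v k
  else if k = M then u M
  else u k

lemma Wfun_eq_samplingPoly (d M : ℕ) (u v : ℕ → ℝ) (k : ℕ) :
    Wfun d M u v k = samplingPoly d (levelGap M u v k) (levelTail M u v k) := by
  unfold Wfun samplingPoly levelGap levelTail
  split_ifs
  · rfl
  · exact Finset.sum_congr rfl fun n _ => mul_right_comm _ _ _
  · exact Finset.sum_congr rfl fun n _ => mul_right_comm _ _ _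
  · rfl

lemma memOmega.abs_levelGap_le {M : ℕ} {u v : ℕ → ℝ} (hM : 2 ≤ M) (h : memOmega M u v)
    {k : ℕ} (hk : 1 ≤ k) : |levelGap M u v k| ≤ 2 := by
  unfold levelGap
  rw [abs_le]
  split_ifs with h1 h2 h3
  · have := h.v_mem (Nat.zero_le (M - 1))
    have := h.v_mem (show 1 ≤ M - 1 by omega)
    constructor <;> linarith
  · have := h.u_mem hk
    have := h.u_mem (show 1 ≤ k - 1 by omega)
    have := h.v_mem h2
    have := h.v_mem (show k - 1 ≤ M - 1 by omega)
    constructor <;> linarith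
  · have := h.u_mem (show 1 ≤ M by omega)
    have := h.u_mem (show 1 ≤ M - 1 by omega)
    have := h.v_mem le_rfl
    constructor <;> linarith
  · have := h.u_mem hk
    have := h.u_mem (show 1 ≤ k - 1 by omega)
    constructor <;> linarith

lemma memOmega.abs_levelTail_le {M : ℕ} {u v : ℕ → ℝ} (hM : 2 ≤ M) (h : memOmega M u v)
    {k : ℕ} (hk : 1 ≤ k) : |levelTail M u v k| ≤ 2 := by
  unfold levelTail
  rw [abs_le]
  split_ifs with h1 h2 h3
  · have := h.u_mem le_rfl
    have := h.v_mem (show 1 ≤ M - 1 by omega)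
    constructor <;> linarith
  · have := h.u_mem hk
    have := h.v_mem h2
    constructor <;> linarith
  · have := h.u_mem (show 1 ≤ M by omega)
    constructor <;> linarith
  · have := h.u_mem hk
    constructor <;> linarith

section Differences

variable {M : ℕ} {u v u' v' : ℕ → ℝ} {δ : ℝ}

lemma abs_levelGap_sub_le (hM : 2 ≤ M) (hu : ∀ k, 1 ≤ k → |u k - u' k| ≤ δ)
    (hv : ∀ j, j ≤ M - 1 → |v j - v' j| ≤ δ) {k : ℕ} (hk : 1 ≤ k) :
    |levelGap M u v k - levelGap M u' v' k| ≤ 4 * δ := by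
  have hδ : 0 ≤ δ := (abs_nonneg _).trans (hu 1 le_rfl)
  unfold levelGap
  rw [abs_le]
  split_ifs with h1 h2 h3
  · have := abs_le.1 (hv 0 (Nat.zero_le _))
    have := abs_le.1 (hv 1 (by omega))
    constructor <;> linarith
  · have := abs_le.1 (hu k hk)
    have := abs_le.1 (hu (k - 1) (by omega))
    have := abs_le.1 (hv k h2)
    have := abs_le.1 (hv (k - 1) (by omega))
    constructor <;> linarith
  · have := abs_le.1 (hu M (by omega))
    have := abs_le.1 (hu (M - 1) (by omega))
    have := abs_le.1 (hv (M - 1) le_rfl)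
    constructor <;> linarith
  · have := abs_le.1 (hu k hk)
    have := abs_le.1 (hu (k - 1) (by omega))
    constructor <;> linarith

lemma abs_levelTail_sub_le (hM : 2 ≤ M) (hu : ∀ k, 1 ≤ k → |u k - u' k| ≤ δ)
    (hv : ∀ j, j ≤ M - 1 → |v j - v' j| ≤ δ) {k : ℕ} (hk : 1 ≤ k) :
    |levelTail M u v k - levelTail M u' v' k| ≤ 4 * δ := by
  have hδ : 0 ≤ δ := (abs_nonneg _).trans (hu 1 le_rfl)
  unfold levelTail
  rw [abs_le]
  split_ifs with h1 h2 h3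
  · have := abs_le.1 (hu 1 le_rfl)
    have := abs_le.1 (hv 1 (by omega))
    constructor <;> linarith
  · have := abs_le.1 (hu k hk)
    have := abs_le.1 (hv k h2)
    constructor <;> linarith
  · have := abs_le.1 (hu M (by omega))
    constructor <;> linarith
  · have := abs_le.1 (hu k hk)
    constructor <;> linarith

end Differences

/-- The drift map of the mean field system is Lipschitz continuous on `Ω` with respect
to the supremum norm, with a constant depending only on `d`, `M`, `λ` and `μ`. -/
theorem drift_lipschitz (d M : ℕ) (hd : 1 ≤ d) (hM : 2 ≤ M)
    (lam mu : ℝ) (hlam : 0 < lam) (hmu : 0 < mu) :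
    ∃ L : ℝ, 0 < L ∧
      ∀ u v u' v' : ℕ → ℝ, memOmega M u v → memOmega M u' v' →
        max (⨆ k : ℕ, |yU d M lam mu u v (k + 1) - yU d M lam mu u' v' (k + 1)|)
            (⨆ j : Fin M, |yV d M lam mu u v j.val - yV d M lam mu u' v' j.val|) ≤
        L * max (⨆ k : ℕ, |u (k + 1) - u' (k + 1)|)
                (⨆ j : Fin M, |v j.val - v' j.val|) := by
  obtain ⟨K, hK0, hK⟩ := exists_lipschitz_mul_samplingPoly d
  refine ⟨lam * (8 * K) + 2 * mu, by positivity, fun u v u' v' h h' => ?_⟩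
  set δ := max (⨆ k : ℕ, |u (k + 1) - u' (k + 1)|) (⨆ j : Fin M, |v j.val - v' j.val|)
  have hu : ∀ k, 1 ≤ k → |u k - u' k| ≤ δ := by
    intro k hk
    obtain ⟨m, rfl⟩ := Nat.exists_eq_add_of_le' hk
    have hbdd : BddAbove (Set.range fun k : ℕ => |u (k + 1) - u' (k + 1)|) := by
      refine ⟨1, ?_⟩
      rintro _ ⟨i, rfl⟩
      exact abs_sub_le_one_of_mem (h.u_mem i.succ_pos) (h'.u_mem i.succ_pos)
    exact (le_ciSup hbdd m).trans (le_max_left _ _)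
  have hv : ∀ j, j ≤ M - 1 → |v j - v' j| ≤ δ := by
    intro j hj
    exact (le_ciSup (f := fun i : Fin M => |v i.val - v' i.val|) (Set.finite_range _).bddAbove
      ⟨j, by omega⟩).trans (le_max_right _ _)
  have hδ : 0 ≤ δ := (abs_nonneg _).trans (hu 1 le_rfl)
  have hterm : ∀ t t' : ℝ, ∀ k, 1 ≤ k → |t| ≤ 2 → |t'| ≤ 2 → |t - t'| ≤ 4 * δ →
      |lam * (t * Wfun d M u v k - t' * Wfun d M u' v' k)| ≤ lam * (4 * K * δ) := by
    intro t t' k hk ht ht' htt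
    rw [abs_mul, abs_of_pos hlam, Wfun_eq_samplingPoly, Wfun_eq_samplingPoly]
    refine mul_le_mul_of_nonneg_left ?_ hlam.le
    refine (hK _ _ _ _ _ _ (4 * δ) ht (h.abs_levelGap_le hM hk) (h.abs_levelTail_le hM hk) ht'
      (h'.abs_levelGap_le hM hk) (h'.abs_levelTail_le hM hk) htt
      (abs_levelGap_sub_le hM hu hv hk) (abs_levelTail_sub_le hM hu hv hk)).trans_eq (by ring)
  have hterm_u : ∀ k, 2 ≤ k → |lam * ((u (k - 1) - u k) * Wfun d M u v k -
      (u' (k - 1) - u' k) * Wfun d M u' v' k)| ≤ lam * (4 * K * δ) := by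
    intro k hk
    have hk1 : 1 ≤ k - 1 := by omega
    have hk0 : 1 ≤ k := by omega
    refine hterm _ _ k hk0
      ((abs_sub_le_one_of_mem (h.u_mem hk1) (h.u_mem hk0)).trans one_le_two)
      ((abs_sub_le_one_of_mem (h'.u_mem hk1) (h'.u_mem hk0)).trans one_le_two) ?_
    have := abs_le.1 (hu k hk0)
    have := abs_le.1 (hu (k - 1) hk1)
    rw [abs_le]
    constructor <;> linarith
  have hterm_v : ∀ j, 1 ≤ j → j ≤ M - 1 → |lam * ((v (j - 1) - v j) * Wfun d M u v j -
      (v' (j - 1) - v' j) * Wfun d M u' v' j)| ≤ lam * (4 * K * δ) := by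
    intro j hj hjM
    have hj1 : j - 1 ≤ M - 1 := by omega
    refine hterm _ _ j hj
      ((abs_sub_le_one_of_mem (h.v_mem hj1) (h.v_mem hjM)).trans one_le_two)
      ((abs_sub_le_one_of_mem (h'.v_mem hj1) (h'.v_mem hjM)).trans one_le_two) ?_
    have := abs_le.1 (hv j hjM)
    have := abs_le.1 (hv (j - 1) hj1)
    rw [abs_le]
    constructor <;> linarith
  have hoverflow := abs_le.1 <| hterm (v (M - 1)) (v' (M - 1)) M (by omega)
    (by rw [abs_le]; constructor <;> linarith [h.v_mem (le_refl (M - 1))])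
    (by rw [abs_le]; constructor <;> linarith [h'.v_mem (le_refl (M - 1))])
    ((hv _ le_rfl).trans (by linarith))
  have hservice : ∀ k, 1 ≤ k →
      |mu * ((u (k + 1) - u k) - (u' (k + 1) - u' k))| ≤ mu * (2 * δ) := by
    intro k hk
    rw [abs_mul, abs_of_pos hmu]
    refine mul_le_mul_of_nonneg_left ?_ hmu.le
    have := abs_le.1 (hu k hk)
    have := abs_le.1 (hu (k + 1) (by omega))
    rw [abs_le]
    constructor <;> linarith
  have hnonneg : 0 ≤ lam * (4 * K * δ) := by positivity
  have : Nonempty (Fin M) := ⟨⟨0, by omega⟩⟩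
  refine max_le (ciSup_le fun m => ?_) (ciSup_le fun j => ?_)
  · generalize hkm : m + 1 = k
    have hk : 1 ≤ k := by omega
    have hs := abs_le.1 (hservice k hk)
    unfold yU
    rw [abs_le]
    split_ifs with h1 h2
    · subst h1
      norm_num at hs
      constructor <;> linarith
    · have := abs_le.1 (hterm_u k (by omega))
      constructor <;> linarith
    · have := abs_le.1 (hterm_u k (by omega))
      constructor <;> linarith
  · have hs := abs_le.1 (hservice 1 le_rfl)
    norm_num at hs
    unfold yV
    rw [abs_le]
    split_ifs with h1
    · constructor <;> linarith
    · have := abs_le.1 (hterm_v j (by omega) (by omega))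
      have : 0 ≤ mu * δ := by positivity
      constructor <;> linarith
end
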